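/- arXiv:1604.03594 — 4 statements merged into one kernel-verified Lean document; each statement's English description precedes it below -/
import Mathlib

section
/- Let R be a factorial domain and f ∈ Int(R) nonzero. For every g ∈ [[f]] and every u ∈ [[f]] ∩ R, one has u ∣ g in the monoid [[f]] if and only if u ∣ d(g) in R. -/
open Pointwise Polynomial

namespace IVP

/-! ### Generic monoid-theoretic notions -/

section Generic

variable {M : Type*} [CommMonoid M]

/-- `u` is a unit of the (sub)monoid given by the subset `S`. -/
def IsMUnit (S : Set M) (u : M) : Prop := u ∈ S ∧ ∃ v ∈ S, u * v = 1

/-- divisibility within the (sub)monoid given by the subset `S`. -/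
def MDvd (S : Set M) (x y : M) : Prop := ∃ c ∈ S, y = x * c

/-- `x` and `y` are associated in the (sub)monoid given by the subset `S`. -/
def MAssoc (S : Set M) (x y : M) : Prop := ∃ ε, IsMUnit S ε ∧ y = x * ε

/-- `u` is an atom (irreducible element) of the (sub)monoid given by `S`. -/
def IsMAtom (S : Set M) (u : M) : Prop :=
  u ∈ S ∧ ¬ IsMUnit S u ∧ ∀ x ∈ S, ∀ y ∈ S, u = x * y → IsMUnit S x ∨ IsMUnit S y

/-- `p` is a prime element of the (sub)monoid given by `S`. -/
def IsMPrime (S : Set M) (p : M) : Prop :=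
  p ∈ S ∧ ¬ IsMUnit S p ∧ ∀ a ∈ S, ∀ b ∈ S, MDvd S p (a * b) → MDvd S p a ∨ MDvd S p b

/-- `I` is an `s`-ideal of the (sub)monoid given by `S`. -/
def IsSIdeal (S I : Set M) : Prop := I ⊆ S ∧ ∀ a ∈ I, ∀ h ∈ S, a * h ∈ I

/-- `I` is a prime `s`-ideal of the (sub)monoid given by `S`. -/
def IsPrimeSIdeal (S I : Set M) : Prop :=
  IsSIdeal S I ∧ ∀ a ∈ S, ∀ b ∈ S, a * b ∈ I → a ∈ I ∨ b ∈ I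

/-- `I` is a height-one prime `s`-ideal (a minimal nonempty prime `s`-ideal) of `S`. -/
def IsHeightOnePrime (S I : Set M) : Prop :=
  IsPrimeSIdeal S I ∧ I.Nonempty ∧
    ∀ J : Set M, IsPrimeSIdeal S J → J.Nonempty → J ⊆ I → J = I

/-- `T` is a divisor-closed submonoid of the (sub)monoid given by `S`. -/
def IsDivisorClosed (S T : Set M) : Prop :=
  T ⊆ S ∧ 1 ∈ T ∧ (∀ x ∈ T, ∀ y ∈ T, x * y ∈ T) ∧ ∀ x ∈ S, ∀ y ∈ S, x * y ∈ T → x ∈ T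

/-- the (sub)monoid given by `S` is factorial: every non-unit is a product of primes. -/
def IsFactorialSet (S : Set M) : Prop :=
  ∀ x ∈ S, ¬ IsMUnit S x → ∃ l : List M, (∀ p ∈ l, IsMPrime S p) ∧ x = l.prod

/-- `X⁻¹ = {z ∣ z X ⊆ S}`, computed in an ambient monoid containing the quotients. -/
def setInv (S X : Set M) : Set M := {z | ∀ x ∈ X, z * x ∈ S}

/-- the divisorial closure `X_v = (X⁻¹)⁻¹` relative to the (sub)monoid given by `S`. -/
def vcl (S X : Set M) : Set M := setInv S (setInv S X)

/-- `I` is a divisorial ideal (`v`-ideal) of the (sub)monoid given by `S`. -/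
def IsVIdeal (S I : Set M) : Prop := I ⊆ S ∧ vcl S I = I

/-- `I` is a principal (`s`-)ideal of the (sub)monoid given by `S`. -/
def IsPrincipalIdl (S I : Set M) : Prop := ∃ a ∈ S, I = {a} * S

/-- the `P`-adic exponent of an ideal `I`, via `v_P(I) ≥ n ↔ I ⊆ (Pⁿ)_v`. -/
noncomputable def vexp (S P I : Set M) : ℕ := sSup {n : ℕ | I ⊆ vcl S (P ^ n)}

/-- the exponent of `g` in `y`, i.e. `sup {n ∣ gⁿ ∣ y}`. -/
noncomputable def expOf (g y : M) : ℕ := sSup {n : ℕ | g ^ n ∣ y}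

/-- two ideals lie in the same divisor class iff they differ by a principal factor. -/
def IdlRel (S : Set M) (P Q : Set M) : Prop := ∃ a ∈ S, ∃ b ∈ S, {b} * P = {a} * Q

theorem subset_vcl (S X : Set M) : X ⊆ vcl S X := by
  intro x hx z hz
  rw [mul_comm]
  exact hz x hx

theorem setInv_anti {S X Y : Set M} (h : X ⊆ Y) : setInv S Y ⊆ setInv S X :=
  fun z hz x hx => hz x (h hx)

theorem vcl_mono {S X Y : Set M} (h : X ⊆ Y) : vcl S X ⊆ vcl S Y :=
  setInv_anti (setInv_anti h)

theorem setInv_vcl (S X : Set M) : setInv S (vcl S X) = setInv S X := by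
  apply Set.Subset.antisymm (setInv_anti (subset_vcl S X))
  intro z hz y hy
  rw [mul_comm]
  exact hy z hz

theorem vcl_idem (S X : Set M) : vcl S (vcl S X) = vcl S X := by
  calc vcl S (vcl S X) = setInv S (setInv S (vcl S X)) := rfl
    _ = setInv S (setInv S X) := by rw [setInv_vcl]
    _ = vcl S X := rfl

theorem hstab_vcl {S X : Set M} (hS : ∀ a ∈ S, ∀ b ∈ S, a * b ∈ S) :
    ∀ z ∈ vcl S X, ∀ h ∈ S, z * h ∈ vcl S X := by
  intro z hz h hh w hw
  have h1 : z * w ∈ S := hz w hw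
  have e : z * h * w = z * w * h := mul_right_comm z h w
  rw [e]
  exact hS _ h1 _ hh

theorem bound_vcl {S X : Set M} {c : M} (hc : ∀ x ∈ X, c * x ∈ S) :
    ∀ y ∈ vcl S X, c * y ∈ S := by
  intro y hy
  rw [mul_comm]
  exact hy c hc

theorem mul_subset_vcl_mul (S X Y : Set M) : vcl S X * Y ⊆ vcl S (X * Y) := by
  rintro _ ⟨a, ha, b, hb, rfl⟩ z hz
  have hzb : ∀ x ∈ X, (z * b) * x ∈ S := by
    intro x hx
    have hxb : x * b ∈ X * Y := Set.mul_mem_mul hx hb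
    have h1 := hz _ hxb
    have e : z * b * x = z * (x * b) := by
      rw [mul_assoc, mul_comm b x]
    rw [e]
    exact h1
  have h2 : a * (z * b) ∈ S := ha _ hzb
  have e2 : a * b * z = a * (z * b) := by
    rw [mul_assoc, mul_comm b z]
  rw [e2]
  exact h2

theorem vcl_mul_vcl_left (S X Y : Set M) : vcl S (vcl S X * Y) = vcl S (X * Y) := by
  apply Set.Subset.antisymm
  · have h1 := vcl_mono (S := S) (mul_subset_vcl_mul S X Y)
    rwa [vcl_idem] at h1
  · exact vcl_mono (Set.mul_subset_mul (subset_vcl S X) subset_rfl)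

theorem vcl_mul_vcl_right (S X Y : Set M) : vcl S (X * vcl S Y) = vcl S (X * Y) := by
  rw [mul_comm X, vcl_mul_vcl_left, mul_comm]

theorem coe_mul_self (H : Submonoid M) : (H : Set M) * (H : Set M) = (H : Set M) := by
  apply Set.Subset.antisymm
  · rintro _ ⟨a, ha, b, hb, rfl⟩
    exact mul_mem ha hb
  · intro x hx
    exact ⟨x, hx, 1, H.one_mem, mul_one x⟩

theorem setInv_coe (H : Submonoid M) : setInv (H : Set M) (H : Set M) = (H : Set M) := by
  apply Set.Subset.antisymm
  · intro z hz
    have h1 := hz 1 H.one_mem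
    rwa [mul_one] at h1
  · intro h hh x hx
    exact mul_mem hh hx

theorem vcl_coe (H : Submonoid M) : vcl (H : Set M) (H : Set M) = (H : Set M) := by
  unfold vcl
  rw [setInv_coe, setInv_coe]

theorem coe_mul_eq (H : Submonoid M) {I : Set M} (hI : vcl (H : Set M) I = I) :
    (H : Set M) * I = I := by
  apply Set.Subset.antisymm
  · rintro _ ⟨h, hh, y, hy, rfl⟩
    show h * y ∈ I
    rw [mul_comm]
    rw [← hI] at hy ⊢
    exact hstab_vcl (fun a ha b hb => mul_mem ha hb) y hy h hh
  · intro x hx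
    exact ⟨1, H.one_mem, x, hx, one_mul x⟩

/-- the setoid identifying height-one primes lying in the same divisor class. -/
def primeSetoid (H : Submonoid M) : Setoid {P : Set M // IsHeightOnePrime (H : Set M) P} where
  r P Q := IdlRel (H : Set M) P.1 Q.1
  iseqv := by
    constructor
    · exact fun P => ⟨1, H.one_mem, 1, H.one_mem, rfl⟩
    · rintro P Q ⟨a, ha, b, hb, h⟩
      exact ⟨b, hb, a, ha, h.symm⟩
    · rintro P Q S ⟨a, ha, b, hb, h1⟩ ⟨a', ha', b', hb', h2⟩
      refine ⟨a * a', mul_mem ha ha', b' * b, mul_mem hb' hb, ?_⟩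
      calc ({b' * b} : Set M) * P.1 = {b'} * ({b} * P.1) := by
            rw [← mul_assoc, Set.singleton_mul_singleton]
        _ = {b'} * ({a} * Q.1) := by rw [h1]
        _ = {a} * ({b'} * Q.1) := by
            rw [← mul_assoc, mul_comm ({b'} : Set M) ({a} : Set M), mul_assoc]
        _ = {a} * ({a'} * S.1) := by rw [h2]
        _ = {a * a'} * S.1 := by rw [← mul_assoc, Set.singleton_mul_singleton]

end Generic

/-! ### Krull monoids -/

section Krull

variable {G : Type*} [CommGroup G]

/-- `H` is completely integrally closed (in its quotient group). -/
def IsCIC (H : Submonoid G) : Prop :=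
  ∀ x : G, (∃ c ∈ H, ∀ n : ℕ, c * x ^ n ∈ H) → x ∈ H

/-- `H` is a Mori monoid: the ascending chain condition on divisorial ideals holds. -/
def IsMori (H : Submonoid G) : Prop :=
  ∀ I : ℕ → Set G, (∀ n, (I n).Nonempty ∧ IsVIdeal (H : Set G) (I n)) →
    (∀ n, I n ⊆ I (n + 1)) → ∃ N, ∀ m, N ≤ m → I m = I N

/-- `H` is a Krull monoid, i.e. a completely integrally closed Mori monoid. -/
def IsKrullMonoid (H : Submonoid G) : Prop := IsCIC H ∧ IsMori H

/-- `H ⊆ T` is a saturated submonoid. -/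
def IsSaturated (H T : Submonoid G) : Prop :=
  ∀ x ∈ H, ∀ y ∈ H, (∃ t ∈ T, y = x * t) → ∃ h ∈ H, y = x * h

end Krull

/-! ### The divisor-class group of a submonoid of (the multiplicative monoid of) a field -/

section ClassGrp

variable {F : Type*} [Field F]

/-- `I` is a fractional divisorial ideal of `H`. -/
def IsFracVIdl (H : Submonoid F) (I : Set F) : Prop :=
  I.Nonempty ∧ (∃ a : F, a ≠ 0 ∧ ∀ x ∈ I, a * x ∈ H) ∧ vcl (H : Set F) I = I

/-- the type of fractional divisorial ideals of `H`. -/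
def FIdl (H : Submonoid F) : Type _ := {I : Set F // IsFracVIdl H I}

theorem isFracVIdl_coe (H : Submonoid F) : IsFracVIdl H (H : Set F) :=
  ⟨⟨1, H.one_mem⟩, ⟨1, one_ne_zero, fun x hx => by rwa [one_mul]⟩, vcl_coe H⟩

theorem isFracVIdl_mul {H : Submonoid F} {I J : Set F}
    (hI : IsFracVIdl H I) (hJ : IsFracVIdl H J) :
    IsFracVIdl H (vcl (H : Set F) (I * J)) := by
  obtain ⟨hne, ⟨a, ha0, ha⟩, hIv⟩ := hI
  obtain ⟨hne', ⟨b, hb0, hb⟩, hJv⟩ := hJ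
  refine ⟨(hne.mul hne').mono (subset_vcl _ _), ⟨a * b, mul_ne_zero ha0 hb0, ?_⟩,
    vcl_idem _ _⟩
  intro x hx
  refine bound_vcl ?_ x hx
  rintro _ ⟨u, hu, v, hv, rfl⟩
  have e : a * b * (u * v) = (a * u) * (b * v) := by ring
  rw [e]
  exact mul_mem (ha u hu) (hb v hv)

instance (H : Submonoid F) : CommMonoid (FIdl H) where
  mul I J := ⟨vcl (H : Set F) (I.1 * J.1), isFracVIdl_mul I.2 J.2⟩
  one := ⟨(H : Set F), isFracVIdl_coe H⟩
  mul_assoc I J K := by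
    apply Subtype.ext
    show vcl _ (vcl _ (I.1 * J.1) * K.1) = vcl _ (I.1 * vcl _ (J.1 * K.1))
    rw [vcl_mul_vcl_left, vcl_mul_vcl_right, mul_assoc]
  one_mul I := by
    apply Subtype.ext
    show vcl _ ((H : Set F) * I.1) = I.1
    rw [coe_mul_eq H I.2.2.2, I.2.2.2]
  mul_one I := by
    apply Subtype.ext
    show vcl _ (I.1 * (H : Set F)) = I.1
    rw [mul_comm, coe_mul_eq H I.2.2.2, I.2.2.2]
  mul_comm I J := by
    apply Subtype.ext
    show vcl _ (I.1 * J.1) = vcl _ (J.1 * I.1)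
    rw [mul_comm]

theorem setInv_prin (H : Submonoid F) {a : F} (ha : a ≠ 0) :
    setInv (H : Set F) ({a} * (H : Set F)) = {a⁻¹} * (H : Set F) := by
  apply Set.Subset.antisymm
  · intro z hz
    have h1 : z * (a * 1) ∈ H := hz _ (Set.mul_mem_mul rfl H.one_mem)
    rw [mul_one] at h1
    refine ⟨a⁻¹, rfl, z * a, h1, ?_⟩
    show a⁻¹ * (z * a) = z
    rw [mul_comm z a, ← mul_assoc, inv_mul_cancel₀ ha, one_mul]
  · rintro _ ⟨s, hs, h, hh, rfl⟩ _ ⟨t, ht, k, hk, rfl⟩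
    rw [Set.mem_singleton_iff] at hs ht
    rw [hs, ht]
    have e : a⁻¹ * h * (a * k) = (a⁻¹ * a) * (h * k) := by ring
    rw [e, inv_mul_cancel₀ ha, one_mul]
    exact mul_mem hh hk

theorem isFracVIdl_prin (H : Submonoid F) {a : F} (ha : a ≠ 0) :
    IsFracVIdl H ({a} * (H : Set F)) := by
  refine ⟨⟨a * 1, Set.mul_mem_mul rfl H.one_mem⟩, ⟨a⁻¹, inv_ne_zero ha, ?_⟩, ?_⟩
  · rintro _ ⟨s, hs, h, hh, rfl⟩
    rw [Set.mem_singleton_iff] at hs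
    rw [hs]
    have e : a⁻¹ * (a * h) = (a⁻¹ * a) * h := by ring
    rw [e, inv_mul_cancel₀ ha, one_mul]
    exact hh
  · unfold vcl
    rw [setInv_prin H ha, setInv_prin H (inv_ne_zero ha), inv_inv]

theorem prin_mul_set (H : Submonoid F) (a b : F) :
    ({a} * (H : Set F)) * ({b} * (H : Set F)) = {a * b} * (H : Set F) := by
  rw [mul_mul_mul_comm, Set.singleton_mul_singleton, coe_mul_self]

/-- the homomorphism sending `a` to the principal fractional ideal `aH`. -/
def prinHom (H : Submonoid F) : Fˣ →* (FIdl H)ˣ where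
  toFun a :=
    { val := ⟨{(a : F)} * (H : Set F), isFracVIdl_prin H a.ne_zero⟩
      inv := ⟨{((a⁻¹ : Fˣ) : F)} * (H : Set F), isFracVIdl_prin H a⁻¹.ne_zero⟩
      val_inv := by
        apply Subtype.ext
        show vcl (H : Set F) (({(a : F)} * (H : Set F)) * ({((a⁻¹ : Fˣ) : F)} * (H : Set F)))
          = (H : Set F)
        rw [prin_mul_set, Units.mul_inv, Set.singleton_one, one_mul, vcl_coe]
      inv_val := by
        apply Subtype.ext
        show vcl (H : Set F) (({((a⁻¹ : Fˣ) : F)} * (H : Set F)) * ({(a : F)} * (H : Set F)))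
          = (H : Set F)
        rw [prin_mul_set, Units.inv_mul, Set.singleton_one, one_mul, vcl_coe] }
  map_one' := by
    apply Units.ext
    apply Subtype.ext
    show ({((1 : Fˣ) : F)} : Set F) * (H : Set F) = (H : Set F)
    rw [Units.val_one, Set.singleton_one, one_mul]
  map_mul' a b := by
    apply Units.ext
    apply Subtype.ext
    show ({((a * b : Fˣ) : F)} : Set F) * (H : Set F)
      = vcl (H : Set F) (({(a : F)} * (H : Set F)) * ({(b : F)} * (H : Set F)))
    rw [prin_mul_set, Units.val_mul,
      (isFracVIdl_prin H (mul_ne_zero a.ne_zero b.ne_zero)).2.2]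

/-- the divisor-class group: `v`-invertible fractional `v`-ideals modulo principal ones. -/
def ClassGrp (H : Submonoid F) : Type _ := (FIdl H)ˣ ⧸ (prinHom H).range

instance (H : Submonoid F) : CommGroup (ClassGrp H) :=
  inferInstanceAs (CommGroup ((FIdl H)ˣ ⧸ (prinHom H).range))

end ClassGrp

/-! ### Integer-valued polynomials over a factorial domain -/

section IntR

variable (R : Type*) [CommRing R] [IsDomain R] [UniqueFactorizationMonoid R]

/-- the quotient field of `R`. -/
abbrev Kq := FractionRing R

/-- the polynomial ring `K[X]` over the quotient field of `R`. -/
abbrev PK := Polynomial (Kq R)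

/-- the field of rational functions, containing the quotient group of `Int(R)•`. -/
abbrev FF := FractionRing (PK R)

/-- the constant polynomial given by `r : R`. -/
noncomputable def cpoly (r : R) : PK R := Polynomial.C (algebraMap R (Kq R) r)

/-- the set of integer-valued polynomials: `g ∈ K[X]` with `g(R) ⊆ R`. -/
def intSet : Set (PK R) :=
  {g | ∀ x : R, ∃ r : R, Polynomial.eval (algebraMap R (Kq R) x) g = algebraMap R (Kq R) r}

/-- the monadic submonoid `[[f]]` of `Int(R)•` generated by `f`. -/
def mon (f : PK R) : Set (PK R) :=
  {g | g ∈ intSet R ∧ g ≠ 0 ∧ ∃ k : ℕ, ∃ h ∈ intSet R, g * h = f ^ k}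

/-- the subring `R[X]`: polynomials all of whose coefficients lie in `R`. -/
def rxSet : Set (PK R) :=
  {g | ∀ n : ℕ, ∃ r : R, g.coeff n = algebraMap R (Kq R) r}

/-- the multiplicative monoid `R[X]•`. -/
def rxnz : Set (PK R) := {g | g ∈ rxSet R ∧ g ≠ 0}

/-- the multiplicative monoid `Int(R)•`. -/
def intnz : Set (PK R) := {g | g ∈ intSet R ∧ g ≠ 0}

/-- `g` is a primitive polynomial in `R[X]`: every common divisor of its coefficients
is a unit of `R`. -/
def IsPrimPoly (g : PK R) : Prop :=
  ∀ r : R, (∀ n : ℕ, ∃ s : R, g.coeff n = algebraMap R (Kq R) (r * s)) → IsUnit r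

/-- `d` is an image-content function: `d g` is a greatest common divisor (in `R`)
of the image `g(R)`. -/
def IsImageGcdFun (d : PK R → R) : Prop :=
  ∀ g ∈ intSet R, g ≠ 0 →
    (∀ x : R, ∃ r : R,
        Polynomial.eval (algebraMap R (Kq R) x) g = algebraMap R (Kq R) (d g * r)) ∧
      ∀ r : R, (∀ x : R, ∃ s : R,
          Polynomial.eval (algebraMap R (Kq R) x) g = algebraMap R (Kq R) (r * s)) →
        r ∣ d g

/-- `e` is a least common multiple in `R` of the set `{d(g·h)/d(h) : h ∈ [[f]]}`,
i.e. `e = e_f(g)` up to associates. -/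
def IsEfVal (d : PK R → R) (f g : PK R) (e : R) : Prop :=
  (∀ h ∈ mon R f, d (g * h) ∣ d h * e) ∧
    ∀ r : R, (∀ h ∈ mon R f, d (g * h) ∣ d h * r) → e ∣ r

theorem intSet_one : (1 : PK R) ∈ intSet R := fun _ => ⟨1, by simp⟩

theorem intSet_mul {g h : PK R} (hg : g ∈ intSet R) (hh : h ∈ intSet R) :
    g * h ∈ intSet R := by
  intro x
  obtain ⟨r, hr⟩ := hg x
  obtain ⟨s, hs⟩ := hh x
  exact ⟨r * s, by rw [Polynomial.eval_mul, hr, hs, map_mul]⟩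

theorem mon_one (f : PK R) : (1 : PK R) ∈ mon R f :=
  ⟨intSet_one R, one_ne_zero, 0, 1, intSet_one R, by simp⟩

theorem mon_mul {f g h : PK R} (hg : g ∈ mon R f) (hh : h ∈ mon R f) :
    g * h ∈ mon R f := by
  obtain ⟨hgI, hg0, k, a, haI, hka⟩ := hg
  obtain ⟨hhI, hh0, l, b, hbI, hlb⟩ := hh
  refine ⟨intSet_mul R hgI hhI, mul_ne_zero hg0 hh0, k + l, a * b, intSet_mul R haI hbI, ?_⟩
  rw [pow_add, ← hka, ← hlb]
  ring

/-- the monadic submonoid `[[f]]`, viewed inside the field of rational functions. -/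
noncomputable def Hmon (f : PK R) : Submonoid (FF R) where
  carrier := algebraMap (PK R) (FF R) '' mon R f
  one_mem' := ⟨1, mon_one R f, map_one _⟩
  mul_mem' := by
    rintro x y ⟨a, ha, rfl⟩ ⟨b, hb, rfl⟩
    exact ⟨a * b, mon_mul R ha hb, map_mul _ _ _⟩

/-- the ideal `gK[X] ∩ [[f]]`, at the level of polynomials. -/
def pIdlP (f g : PK R) : Set (PK R) := {z | z ∈ mon R f ∧ ∃ h : PK R, z = g * h}

/-- the ideal `gK[X] ∩ [[f]]`, inside the field of rational functions. -/
noncomputable def pIdl (f g : PK R) : Set (FF R) := algebraMap (PK R) (FF R) '' pIdlP R f g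

end IntR

end IVP

open IVP Pointwise Polynomial
/-- Lemma `general`.1. -/
theorem stmt_0 (R : Type*) [CommRing R] [IsDomain R] [UniqueFactorizationMonoid R]
    (d : PK R → R) (hd : IsImageGcdFun R d)
    (f : PK R) (hf : f ∈ intSet R) (hf0 : f ≠ 0)
    (g : PK R) (hg : g ∈ mon R f)
    (u : R) (hu : cpoly R u ∈ mon R f) :
    MDvd (mon R f) (cpoly R u) g ↔ u ∣ d g := by
  have hu0 : algebraMap R (Kq R) u ≠ 0 := by
    intro h
    apply hu.2.1
    simp [cpoly, h]
  obtain ⟨hgI, hg0, k, h, hhI, hk⟩ := hg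
  obtain ⟨hd1, hd2⟩ := hd g hgI hg0
  constructor
  · rintro ⟨c, hc, hgc⟩
    apply hd2
    intro x
    obtain ⟨s, hs⟩ := hc.1 x
    refine ⟨s, ?_⟩
    rw [hgc, Polynomial.eval_mul, hs, map_mul]
    simp [cpoly]
  · rintro ⟨w, hw⟩
    have key : g = cpoly R u * (Polynomial.C (algebraMap R (Kq R) u)⁻¹ * g) := by
      rw [cpoly, ← mul_assoc, ← Polynomial.C_mul, mul_inv_cancel₀ hu0, Polynomial.C_1, one_mul]
    refine ⟨Polynomial.C (algebraMap R (Kq R) u)⁻¹ * g, ⟨?_, ?_, k, cpoly R u * h, ?_, ?_⟩, key⟩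
    · intro x
      obtain ⟨r, hr⟩ := hd1 x
      refine ⟨w * r, ?_⟩
      rw [Polynomial.eval_mul, hr, hw, Polynomial.eval_C, mul_assoc, map_mul _ u,
        ← mul_assoc, inv_mul_cancel₀ hu0, one_mul]
    · exact mul_ne_zero (Polynomial.C_ne_zero.mpr (inv_ne_zero hu0)) hg0
    · exact intSet_mul R hu.1 hhI
    · rw [← hk]
      conv_rhs => rw [key]
      ring
end

section
/- Let R be a factorial domain and f ∈ Int(R) nonzero. Then the set of constant atoms of [[f]] satisfies 𝒜([[f]]) ∩ R = [[f]] ∩ 𝒜(R) = {u ∈ 𝒜(R) : u ∣_R d(f)}, where 𝒜(−) denotes the set of atoms (irreducible elements) of a monoid. -/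
open Pointwise Polynomial

open IVP Pointwise Polynomial

theorem aux_cmem (R : Type*) [CommRing R] [IsDomain R] [UniqueFactorizationMonoid R] (a : R) :
    cpoly R a ∈ intSet R := fun x => ⟨a, by simp [cpoly]⟩

theorem aux_cmul (R : Type*) [CommRing R] [IsDomain R] [UniqueFactorizationMonoid R] (a b : R) :
    cpoly R (a * b) = cpoly R a * cpoly R b := by simp [cpoly]

theorem aux_cinj (R : Type*) [CommRing R] [IsDomain R] [UniqueFactorizationMonoid R] {a b : R}
    (h : cpoly R a = cpoly R b) : a = b :=
  IsFractionRing.injective R (Kq R) (Polynomial.C_injective h)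

theorem aux_c1 (R : Type*) [CommRing R] [IsDomain R] [UniqueFactorizationMonoid R] :
    cpoly R 1 = 1 := by simp [cpoly]

theorem aux_c0 (R : Type*) [CommRing R] [IsDomain R] [UniqueFactorizationMonoid R] :
    cpoly R 0 = 0 := by simp [cpoly]

theorem aux_unit (R : Type*) [CommRing R] [IsDomain R] [UniqueFactorizationMonoid R]
    (f : PK R) (a : R) : IsMUnit (mon R f) (cpoly R a) ↔ IsUnit a := by
  constructor
  · rintro ⟨-, v, hv, h⟩
    obtain ⟨r, hr⟩ := hv.1 0
    have h2 := congrArg (Polynomial.eval (algebraMap R (Kq R) 0)) h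
    rw [Polynomial.eval_mul, hr] at h2
    simp only [cpoly, Polynomial.eval_C, Polynomial.eval_one, ← map_mul] at h2
    rw [← map_one (algebraMap R (Kq R))] at h2
    exact IsUnit.of_mul_eq_one _ (IsFractionRing.injective R (Kq R) h2)
  · intro h
    obtain ⟨b, hb⟩ := h.exists_right_inv
    have e : cpoly R a * cpoly R b = 1 := by rw [← aux_cmul, hb, aux_c1]
    refine ⟨⟨aux_cmem R a, left_ne_zero_of_mul_eq_one e, 0, _, aux_cmem R b, by simpa using e⟩,
      cpoly R b, ⟨aux_cmem R b, right_ne_zero_of_mul_eq_one e, 0, _, aux_cmem R a, ?_⟩, e⟩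
    rw [mul_comm]; simpa using e

theorem aux_div (R : Type*) [CommRing R] [IsDomain R] [UniqueFactorizationMonoid R]
    (f : PK R) (a b : R) (h : cpoly R (a * b) ∈ mon R f) : cpoly R a ∈ mon R f := by
  obtain ⟨-, h0, k, g, hg, e⟩ := h
  rw [aux_cmul] at h0 e
  exact ⟨aux_cmem R a, left_ne_zero_of_mul h0, k, cpoly R b * g,
    intSet_mul R (aux_cmem R b) hg, by rw [← e, mul_assoc]⟩

theorem aux_const (R : Type*) [CommRing R] [IsDomain R] [UniqueFactorizationMonoid R]
    (g : PK R) (hg : g ∈ intSet R) (h : g.natDegree = 0) : ∃ a, g = cpoly R a := by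
  obtain ⟨r, hr⟩ := hg 0
  refine ⟨r, ?_⟩
  rw [Polynomial.eq_C_of_natDegree_eq_zero h] at hr ⊢
  simp only [Polynomial.eval_C] at hr
  rw [hr, cpoly]

/-- Lemma `general`.2. -/
theorem stmt_1 (R : Type*) [CommRing R] [IsDomain R] [UniqueFactorizationMonoid R]
    (d : PK R → R) (hd : IsImageGcdFun R d)
    (f : PK R) (hf : f ∈ intSet R) (hf0 : f ≠ 0) (u : R) :
    (IsMAtom (mon R f) (cpoly R u) ↔ cpoly R u ∈ mon R f ∧ Irreducible u) ∧
      ((cpoly R u ∈ mon R f ∧ Irreducible u) ↔ Irreducible u ∧ u ∣ d f) := by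
  refine ⟨⟨?_, ?_⟩, ⟨?_, ?_⟩⟩
  · rintro ⟨hm, hn, hx⟩
    refine ⟨hm, ⟨fun h => hn ((aux_unit R f u).2 h), ?_⟩⟩
    rintro a b rfl
    have := hx _ (aux_div R f a b hm) _ (aux_div R f b a (by rwa [mul_comm])) (aux_cmul R a b)
    simpa only [aux_unit] using this
  · rintro ⟨hm, hu⟩
    refine ⟨hm, fun h => hu.not_isUnit ((aux_unit R f u).1 h), ?_⟩
    intro x hx y hy e
    have hdeg := congrArg Polynomial.natDegree e
    rw [Polynomial.natDegree_mul hx.2.1 hy.2.1, cpoly, Polynomial.natDegree_C] at hdeg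
    obtain ⟨a, rfl⟩ := aux_const R x hx.1 (by omega)
    obtain ⟨b, rfl⟩ := aux_const R y hy.1 (by omega)
    rw [← aux_cmul] at e
    rw [aux_unit, aux_unit]
    exact hu.isUnit_or_isUnit (aux_cinj R e)
  · rintro ⟨⟨-, -, k, h, hh, e⟩, hu⟩
    refine ⟨hu, (hd f hf hf0).2 u fun x => ?_⟩
    obtain ⟨s, hs⟩ := hf x
    obtain ⟨r, hr⟩ := hh x
    have h2 := congrArg (Polynomial.eval (algebraMap R (Kq R) x)) e
    rw [Polynomial.eval_mul, Polynomial.eval_pow, hr, hs, cpoly, Polynomial.eval_C, ← map_mul,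
      ← map_pow] at h2
    have h3 : u ∣ s ^ k := ⟨r, (IsFractionRing.injective R (Kq R) h2).symm⟩
    obtain ⟨t, rfl⟩ := hu.prime.dvd_of_dvd_pow h3
    exact ⟨t, hs⟩
  · rintro ⟨hu, hdu⟩
    have hu0 : algebraMap R (Kq R) u ≠ 0 := fun h =>
      hu.ne_zero (IsFractionRing.injective R (Kq R) (by rw [h, map_zero]))
    refine ⟨⟨aux_cmem R u, by rw [cpoly]; exact Polynomial.C_ne_zero.2 hu0, 1,
      Polynomial.C (algebraMap R (Kq R) u)⁻¹ * f, ?_, ?_⟩, hu⟩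
    · intro x
      obtain ⟨r, hr⟩ := (hd f hf hf0).1 x
      obtain ⟨t, ht⟩ := hdu
      refine ⟨t * r, ?_⟩
      rw [Polynomial.eval_mul, hr, Polynomial.eval_C, ht, mul_assoc, map_mul, ← mul_assoc,
        inv_mul_cancel₀ hu0, one_mul]
    · rw [cpoly, ← mul_assoc, ← Polynomial.C_mul, mul_inv_cancel₀ hu0]
      simp
end

section
/- Let R be a factorial domain, K a quotient field of R, X an indeterminate over K, and f ∈ R[X] nonzero. For every g ∈ [[f]] there exist a, b ∈ [[f]] ∩ R and a primitive polynomial h ∈ [[f]] ∩ R[X] such that h divides f^k in R[X] for some k ∈ ℕ, the only common divisors of a and b in R are units, and g = bh/a. -/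
open Pointwise Polynomial

open IVP Pointwise Polynomial
/-- Lemma `represent`. -/
theorem stmt_5 (R : Type*) [CommRing R] [IsDomain R] [UniqueFactorizationMonoid R]
    (f : PK R) (hf : f ∈ rxSet R) (hf0 : f ≠ 0)
    (g : PK R) (hg : g ∈ mon R f) :
    ∃ (a b : R) (h : PK R),
      cpoly R a ∈ mon R f ∧ cpoly R b ∈ mon R f ∧
      h ∈ mon R f ∧ h ∈ rxSet R ∧ IsPrimPoly R h ∧
      (∃ k : ℕ, 0 < k ∧ ∃ q ∈ rxSet R, h * q = f ^ k) ∧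
      (∀ r : R, r ∣ a → r ∣ b → IsUnit r) ∧
      cpoly R a * g = cpoly R b * h := by
  classical
  obtain ⟨hgI, hg0, k0, g0, hg0I, hk0⟩ := hg
  -- make the exponent positive
  have hfI : f ∈ intSet R := by
    choose c hc using hf
    have : f = (∑ i ∈ Finset.range (f.natDegree + 1), monomial i (c i)).map
        (algebraMap R (Kq R)) := by
      conv_lhs => rw [f.as_sum_range]
      simp [Polynomial.map_sum, hc]
    intro x
    rw [this]
    exact ⟨_, by rw [Polynomial.eval_map_algebraMap, Polynomial.aeval_algebraMap_apply]⟩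
  obtain ⟨k, hkpos, g', hg'I, hk⟩ : ∃ k : ℕ, 0 < k ∧ ∃ g' ∈ intSet R, g * g' = f ^ k :=
    ⟨k0 + 1, Nat.succ_pos _, g0 * f, intSet_mul R hg0I hfI, by
      rw [← mul_assoc, hk0, pow_succ]⟩
  let : NormalizedGCDMonoid R := Nonempty.some inferInstance
  have hinj : Function.Injective (algebraMap R (Kq R)) := IsFractionRing.injective R (Kq R)
  have hrxmap : ∀ p : R[X], p.map (algebraMap R (Kq R)) ∈ rxSet R :=
    fun p n => ⟨p.coeff n, by simp⟩
  have hintmap : ∀ p : R[X], p.map (algebraMap R (Kq R)) ∈ intSet R := fun p x =>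
    ⟨p.eval x, by rw [Polynomial.eval_map_algebraMap, Polynomial.aeval_algebraMap_apply]; simp⟩
  obtain ⟨F, hF⟩ : ∃ F : R[X], F.map (algebraMap R (Kq R)) = f := by
    have : f ∈ Polynomial.lifts (algebraMap R (Kq R)) := by
      rw [Polynomial.lifts_iff_coeff_lifts]
      intro n
      obtain ⟨r, hr⟩ := hf n
      exact ⟨r, hr.symm⟩
    exact (Polynomial.mem_lifts _).1 this
  obtain ⟨d, hd, hdP⟩ := IsLocalization.integerNormalization_spec (nonZeroDivisors R) g
  have hd0 : d ≠ 0 := nonZeroDivisors.ne_zero hd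
  set P := IsLocalization.integerNormalization (nonZeroDivisors R) g with hP
  obtain ⟨a, b, t, hrel, hta, htb⟩ :=
    UniqueFactorizationMonoid.exists_reduced_factors d hd0 P.content
  set h0 := P.primPart with hh0
  have hprim : h0.IsPrimitive := P.isPrimitive_primPart
  have ht0 : t ≠ 0 := by rintro rfl; simp at hta; exact hd0 hta.symm
  have ha0 : a ≠ 0 := by rintro rfl; simp at hta; exact hd0 hta.symm
  set h : PK R := h0.map (algebraMap R (Kq R)) with hh
  have hcp : ∀ r : R, cpoly R r = (C r : R[X]).map (algebraMap R (Kq R)) := by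
    intro r; simp [cpoly]
  have hcmul : ∀ r s : R, cpoly R (r * s) = cpoly R r * cpoly R s := by
    intro r s; simp [cpoly]
  have hcne : ∀ r : R, r ≠ 0 → cpoly R r ≠ 0 := by
    intro r hr; simpa [cpoly] using hr
  have hmain : cpoly R a * g = cpoly R b * h := by
    apply mul_left_cancel₀ (hcne t ht0)
    rw [← mul_assoc, ← mul_assoc, ← hcmul, ← hcmul, hta, htb]
    have h1 : cpoly R d * g = P.map (algebraMap R (Kq R)) := by
      rw [hdP, cpoly, Algebra.smul_def, Polynomial.algebraMap_apply]
    rw [h1, hcp, hh, ← Polynomial.map_mul, ← P.eq_C_content_mul_primPart]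
  have hb0 : b ≠ 0 := by
    rintro rfl
    have : cpoly R (0 : R) = 0 := by simp [cpoly]
    rw [this, zero_mul] at hmain
    exact mul_ne_zero (hcne a ha0) hg0 hmain
  have hhne : h ≠ 0 := by
    intro h1
    rw [h1, mul_zero] at hmain
    exact mul_ne_zero (hcne a ha0) hg0 hmain
  -- the quotient `h / a` is integer-valued
  obtain ⟨w, hwa, hw⟩ : ∃ w : PK R, cpoly R a * w = h ∧ h ∣ w := by
    refine ⟨C (algebraMap R (Kq R) a)⁻¹ * h, ?_, dvd_mul_left _ _⟩
    have : algebraMap R (Kq R) a ≠ 0 := by simpa using ha0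
    rw [cpoly, ← mul_assoc, ← C_mul, mul_inv_cancel₀ this, C_1, one_mul]
  have hwb : g = cpoly R b * w := by
    apply mul_left_cancel₀ (hcne a ha0)
    rw [hmain, ← hwa]; ring
  have hwI : w ∈ intSet R := by
    intro x
    obtain ⟨r, hr⟩ := hgI x
    have e1 := congrArg (Polynomial.eval (algebraMap R (Kq R) x)) hmain
    have e2 := congrArg (Polynomial.eval (algebraMap R (Kq R) x)) hwa
    obtain ⟨s, hs⟩ := hintmap h0 x
    rw [← hh] at hs
    simp only [Polynomial.eval_mul, cpoly, Polynomial.eval_C, hr, hs] at e1 e2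
    rw [← map_mul, ← map_mul] at e1
    have e3 := hinj e1
    have : a ∣ s := hrel.dvd_of_dvd_mul_left ⟨r, e3.symm⟩
    obtain ⟨z, rfl⟩ := this
    refine ⟨z, ?_⟩
    have : algebraMap R (Kq R) a ≠ 0 := by simpa using ha0
    apply mul_left_cancel₀ this
    rw [e2, map_mul]
  have hFk : f ^ k = (F ^ k).map (algebraMap R (Kq R)) := by rw [Polynomial.map_pow, hF]
  -- Gauss
  have hdvd : h0 ∣ F ^ k := by
    apply Polynomial.IsPrimitive.dvd_of_fraction_map_dvd_fraction_map (K := Kq R) hprim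
    rw [← hFk, ← hk, hwb]
    exact (hw.mul_left _).mul_right _
  obtain ⟨q, hq⟩ := hdvd
  have hhq : h * q.map (algebraMap R (Kq R)) = f ^ k := by
    rw [hFk, hq, Polynomial.map_mul]
  refine ⟨a, b, h, ⟨?_, hcne a ha0, k, w * q.map (algebraMap R (Kq R)), ?_, ?_⟩,
    ⟨?_, hcne b hb0, k, w * g', ?_, ?_⟩, ⟨hintmap _, hhne, k, _, hintmap q, hhq⟩, hrxmap _, ?_,
    ⟨k, hkpos, _, hrxmap q, hhq⟩, fun r h1 h2 => hrel h1 h2, hmain⟩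
  · rw [hcp]; exact hintmap _
  · exact intSet_mul R hwI (hintmap _)
  · rw [← mul_assoc, hwa, hhq]
  · rw [hcp]; exact hintmap _
  · exact intSet_mul R hwI hg'I
  · rw [← mul_assoc, ← hwb, hk]
  · intro r hr
    apply hprim r
    rw [Polynomial.C_dvd_iff_dvd_coeff]
    intro n
    obtain ⟨s, hs⟩ := hr n
    rw [hh, Polynomial.coeff_map] at hs
    exact ⟨s, hinj hs⟩
end

section
/- Let R be a factorial domain, K a field of quotients of R, X an indeterminate over K, and f ∈ R[X] nonzero. Then {P ∈ 𝔛([[f]]) : P ∩ R = ∅} = {gK[X] ∩ [[f]] : g ∈ [[f]] ∩ 𝒜(R[X])\R} = {gK[X] ∩ [[f]] : g ∈ [[f]] ∩ 𝒜(K[X])}. Moreover, if ℛ is a system of representatives (up to associates in [[f]]) of [[f]] ∩ 𝒜(R[X])\R, then the map t ↦ tK[X] ∩ [[f]] is a bijection from ℛ onto {P ∈ 𝔛([[f]]) : P ∩ R = ∅}. -/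
open Pointwise Polynomial

namespace IVP

section Helpers

variable {R : Type*} [CommRing R] [IsDomain R] [UniqueFactorizationMonoid R]

/-- the image of `g : R[X]` in `K[X]`. -/
noncomputable abbrev mp (g : R[X]) : PK R := g.map (algebraMap R (Kq R))

theorem mp_inj : Function.Injective (mp (R := R)) :=
  Polynomial.map_injective _ (IsFractionRing.injective R (Kq R))

theorem mp_mul (g h : R[X]) : mp (g * h) = mp g * mp h := Polynomial.map_mul _

theorem mp_C (r : R) : mp (C r) = cpoly R r := Polynomial.map_C _

theorem mp_one : mp (1 : R[X]) = 1 := Polynomial.map_one _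

theorem mp_zero : mp (0 : R[X]) = 0 := Polynomial.map_zero _

theorem mp_ne_zero {g : R[X]} (h : g ≠ 0) : mp g ≠ 0 := fun h' => h (mp_inj (h'.trans mp_zero.symm))

theorem mp_natDegree (g : R[X]) : (mp g).natDegree = g.natDegree :=
  Polynomial.natDegree_map_eq_of_injective (IsFractionRing.injective R (Kq R)) g

theorem mp_int (g : R[X]) : mp g ∈ intSet R := fun x =>
  ⟨g.eval x, by rw [mp, Polynomial.eval_map_apply]⟩

theorem mp_rx (g : R[X]) : mp g ∈ rxSet R := fun n =>
  ⟨g.coeff n, Polynomial.coeff_map _ _⟩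

theorem rx_lift {g : PK R} (h : g ∈ rxSet R) : ∃ g0 : R[X], mp g0 = g := by
  refine (Polynomial.mem_lifts (f := algebraMap R (Kq R)) g).1 ?_
  refine (Polynomial.lifts_iff_coeff_lifts g).2 fun n => ?_
  obtain ⟨r, hr⟩ := h n
  exact ⟨r, hr.symm⟩

theorem rxunit_iff (g : R[X]) : IsMUnit (rxnz R) (mp g) ↔ IsUnit g := by
  constructor
  · rintro ⟨-, v, ⟨hv, -⟩, h⟩
    obtain ⟨v, rfl⟩ := rx_lift hv
    rw [← mp_mul, ← mp_one] at h
    exact IsUnit.of_mul_eq_one _ (mp_inj h)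
  · intro h
    obtain ⟨v, hv⟩ := h.exists_right_inv
    have hv' : mp g * mp v = 1 := by rw [← mp_mul, hv, mp_one]
    refine ⟨⟨mp_rx g, left_ne_zero_of_mul_eq_one hv'⟩, mp v, ⟨mp_rx v, right_ne_zero_of_mul_eq_one hv'⟩, hv'⟩

theorem atom_iff (g : R[X]) : IsMAtom (rxnz R) (mp g) ↔ Irreducible g := by
  constructor
  · rintro ⟨⟨-, h0⟩, h1, h2⟩
    refine ⟨fun h => h1 ((rxunit_iff g).2 h), fun a b hab => ?_⟩
    subst hab
    rw [mp_mul] at h0 h2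
    have := h2 (mp a) ⟨mp_rx a, left_ne_zero_of_mul h0⟩ (mp b) ⟨mp_rx b, right_ne_zero_of_mul h0⟩ rfl
    rwa [rxunit_iff, rxunit_iff] at this
  · intro h
    refine ⟨⟨mp_rx g, mp_ne_zero h.ne_zero⟩, fun h' => h.not_isUnit ((rxunit_iff g).1 h'), ?_⟩
    rintro x ⟨hx, -⟩ y ⟨hy, -⟩ hxy
    obtain ⟨x, rfl⟩ := rx_lift hx
    obtain ⟨y, rfl⟩ := rx_lift hy
    rw [rxunit_iff, rxunit_iff]
    rw [← mp_mul] at hxy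
    exact h.isUnit_or_isUnit (mp_inj hxy)

theorem mon_of_mul {f x y : PK R} (hx : x ∈ intSet R) (hy : y ∈ intSet R) (h : x * y ∈ mon R f) :
    x ∈ mon R f := by
  obtain ⟨-, h0, k, w, hw, hk⟩ := h
  exact ⟨hx, left_ne_zero_of_mul h0, k, y * w, intSet_mul R hy hw, by rw [← hk, mul_assoc]⟩

theorem cpoly_unit {r : R} (hr : r ≠ 0) : IsUnit (cpoly R r) := by
  unfold cpoly
  rw [Polynomial.isUnit_C, isUnit_iff_ne_zero]
  exact fun h => hr (IsFractionRing.injective R (Kq R) (h.trans (map_zero _).symm))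

theorem exists_red {z : PK R} (hz : z ∈ intSet R) (hz0 : z ≠ 0) :
    ∃ (a b : R) (z0 : R[X]), a ≠ 0 ∧ b ≠ 0 ∧ z0.IsPrimitive ∧
      cpoly R b * z = cpoly R a * mp z0 ∧ ∃ q ∈ intSet R, mp z0 = cpoly R b * q := by
  let _ : StrongNormalizationMonoid R := UniqueFactorizationMonoid.strongNormalizationMonoid
  let _ : NormalizedGCDMonoid R := UniqueFactorizationMonoid.toNormalizedGCDMonoid R
  obtain ⟨b, hb, hw⟩ := IsLocalization.integerNormalization_spec (nonZeroDivisors R) z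
  set w := IsLocalization.integerNormalization (nonZeroDivisors R) z
  have hb0 : b ≠ 0 := nonZeroDivisors.ne_zero hb
  have hbz : mp w = cpoly R b * z := by
    rw [mp, hw, cpoly, Polynomial.C_mul', algebraMap_smul]
  obtain ⟨b', a', c', hrel, hb', ha'⟩ :=
    UniqueFactorizationMonoid.exists_reduced_factors b hb0 w.content
  have hw0 : w ≠ 0 := by
    intro h
    rw [h, mp_zero] at hbz
    exact mul_ne_zero (cpoly_unit hb0).ne_zero hz0 hbz.symm
  have hcont : w.content ≠ 0 := fun h => hw0 (Polynomial.content_eq_zero_iff.1 h)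
  have hc0 : c' ≠ 0 := by rintro rfl; simp at hb'; exact hb0 hb'.symm
  have hb0' : b' ≠ 0 := by rintro rfl; simp at hb'; exact hb0 hb'.symm
  have ha0' : a' ≠ 0 := by rintro rfl; simp at ha'; exact hcont ha'.symm
  have key : cpoly R b' * z = cpoly R a' * mp w.primPart := by
    apply mul_left_cancel₀ (cpoly_unit hc0).ne_zero
    have e : ∀ x y : R, cpoly R (x * y) = cpoly R x * cpoly R y := by
      intro x y; simp [cpoly]
    rw [← mul_assoc, ← mul_assoc, ← e, ← e, hb', ha', ← hbz, ← mp_C, ← mp_mul,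
      ← Polynomial.eq_C_content_mul_primPart]
  refine ⟨a', b', w.primPart, ha0', hb0', w.isPrimitive_primPart, key, ?_⟩
  obtain ⟨q, hq⟩ := (cpoly_unit hb0').dvd (a := mp w.primPart)
  refine ⟨q, fun x => ?_, hq⟩
  obtain ⟨r, hr⟩ := hz x
  have h1 := congrArg (Polynomial.eval (algebraMap R (Kq R) x)) key
  have h2 := congrArg (Polynomial.eval (algebraMap R (Kq R) x)) hq
  rw [Polynomial.eval_mul, Polynomial.eval_mul, hr, cpoly, cpoly, Polynomial.eval_C,
    Polynomial.eval_C, mp, Polynomial.eval_map_apply, ← map_mul, ← map_mul] at h1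
  have h3 := IsFractionRing.injective R (Kq R) h1
  have h4 : b' ∣ w.primPart.eval x := hrel.dvd_of_dvd_mul_left (Dvd.intro _ h3)
  obtain ⟨s, hs⟩ := h4
  rw [mp, Polynomial.eval_map_apply, hs, map_mul, Polynomial.eval_mul, cpoly,
    Polynomial.eval_C] at h2
  refine ⟨s, (mul_left_cancel₀ ?_ h2).symm⟩
  exact fun h => hb0' (IsFractionRing.injective R (Kq R) (h.trans (map_zero _).symm))

theorem mon_red {f z : PK R} (hf : f ∈ rxSet R) (hf0 : f ≠ 0) (hz : z ∈ mon R f) :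
    ∃ (a b : R) (z0 : R[X]), a ≠ 0 ∧ b ≠ 0 ∧ cpoly R a ∈ mon R f ∧ cpoly R b ∈ mon R f ∧
      z0.IsPrimitive ∧ mp z0 ∈ mon R f ∧ cpoly R b * z = cpoly R a * mp z0 := by
  let _ : StrongNormalizationMonoid R := UniqueFactorizationMonoid.strongNormalizationMonoid
  let _ : NormalizedGCDMonoid R := UniqueFactorizationMonoid.toNormalizedGCDMonoid R
  obtain ⟨f0, rfl⟩ := rx_lift hf
  obtain ⟨hzi, hz0, k, h, hh, hk⟩ := hz
  have hh0 : h ≠ 0 := right_ne_zero_of_mul (hk ▸ pow_ne_zero k hf0)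
  obtain ⟨a, b, z0, ha, hb, hp, e, q, hq, hq'⟩ := exists_red hzi hz0
  obtain ⟨a', b', h0, ha', hb', hp', e', q', hqi', hq''⟩ := exists_red hh hh0
  have ci : ∀ r : R, cpoly R r ∈ intSet R := fun r => mp_C r ▸ mp_int _
  have hpow : mp (f0 ^ k) = mp f0 ^ k := Polynomial.map_pow _ _
  have E : cpoly R b * cpoly R b' * mp (f0 ^ k) = cpoly R a * cpoly R a' * mp (z0 * h0) := by
    rw [hpow, ← hk, mp_mul]
    linear_combination (cpoly R b' * h) * e + (cpoly R a * mp z0) * e'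
  have hd : z0 * h0 ∣ f0 ^ k := by
    apply (hp.mul hp').dvd_of_fraction_map_dvd_fraction_map (K := Kq R)
    have : mp (z0 * h0) ∣ cpoly R b * cpoly R b' * mp (f0 ^ k) := Dvd.intro_left _ E.symm
    exact ((cpoly_unit hb).mul (cpoly_unit hb')).dvd_mul_left.1 this
  have fk : mp (f0 ^ k) ∈ mon R (mp f0) :=
    ⟨mp_int _, hpow ▸ pow_ne_zero k hf0, k, 1, intSet_one R, by rw [mul_one, hpow]⟩
  have zh : mp (z0 * h0) ∈ mon R (mp f0) := by
    obtain ⟨c, hc⟩ := hd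
    apply mon_of_mul (mp_int _) (mp_int c)
    rwa [← mp_mul, ← hc]
  have zm : mp z0 ∈ mon R (mp f0) :=
    mon_of_mul (mp_int _) (mp_int h0) (by rwa [← mp_mul])
  have hm : mp h0 ∈ mon R (mp f0) :=
    mon_of_mul (mp_int _) (mp_int z0) (by rwa [← mp_mul, mul_comm])
  have bm : cpoly R b ∈ mon R (mp f0) := mon_of_mul (ci _) hq (hq' ▸ zm)
  have bm' : cpoly R b' ∈ mon R (mp f0) := mon_of_mul (ci _) hqi' (hq'' ▸ hm)
  have am : cpoly R a ∈ mon R (mp f0) := by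
    have : cpoly R a * (cpoly R a' * mp (z0 * h0)) ∈ mon R (mp f0) := by
      rw [← mul_assoc, ← E]
      exact mon_mul R (mon_mul R bm bm') fk
    exact mon_of_mul (ci _) (intSet_mul R (ci _) (mp_int _)) this
  exact ⟨a, b, z0, ha, hb, am, bm, hp, zm, e⟩

theorem exists_irr {f : PK R} {J : Set (PK R)} (hJ : IsPrimeSIdeal (mon R f) J)
    (hJR : ∀ r : R, cpoly R r ∉ J) (x : R[X]) : mp x ∈ J → ∃ p, Irreducible p ∧ mp p ∈ J := by
  induction x using WfDvdMonoid.induction_on_irreducible with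
  | zero => intro h; exact absurd mp_zero (hJ.1.1 h).2.1
  | unit u hu =>
    intro h
    obtain ⟨r, -, rfl⟩ := Polynomial.isUnit_iff.1 hu
    rw [mp_C] at h
    exact absurd h (hJR r)
  | mul a i ha hi ih =>
    intro h
    rw [mp_mul] at h
    have hm := hJ.1.1 h
    rcases hJ.2 _ (mon_of_mul (mp_int _) (mp_int _) hm) _
      (mon_of_mul (mp_int _) (mp_int _) (mul_comm (mp i) (mp a) ▸ hm)) h with h1 | h1
    · exact ⟨i, hi, h1⟩
    · exact ih h1

theorem key_prime {f : PK R} (hf : f ∈ rxSet R) (hf0 : f ≠ 0) {J : Set (PK R)}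
    (hJ : IsPrimeSIdeal (mon R f) J) (hne : J.Nonempty) (hJR : ∀ r : R, cpoly R r ∉ J) :
    ∃ p : R[X], Irreducible p ∧ 0 < p.natDegree ∧ mp p ∈ mon R f ∧ pIdlP R f (mp p) ⊆ J := by
  obtain ⟨z, hz⟩ := hne
  obtain ⟨a, b, z0, ha, hb, am, bm, hp, zm, e⟩ := mon_red hf hf0 (hJ.1.1 hz)
  have h1 : cpoly R a * mp z0 ∈ J := by
    rw [← e, mul_comm]
    exact hJ.1.2 _ hz _ bm
  have h2 := (hJ.2 _ am _ zm h1).resolve_left (hJR a)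
  obtain ⟨p, hpi, hpJ⟩ := exists_irr hJ hJR z0 h2
  have hdeg : 0 < p.natDegree := by
    by_contra hcon
    have := Polynomial.eq_C_of_natDegree_eq_zero (Nat.eq_zero_of_not_pos hcon)
    rw [this, mp_C] at hpJ
    exact hJR _ hpJ
  refine ⟨p, hpi, hdeg, hJ.1.1 hpJ, ?_⟩
  rintro y ⟨hy, h, hyh⟩
  obtain ⟨a, b, y0, ha, hb, am, bm, hp, ym, e⟩ := mon_red hf hf0 hy
  have hd : p ∣ y0 := by
    apply (hpi.isPrimitive hdeg.ne').dvd_of_fraction_map_dvd_fraction_map (K := Kq R)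
    have : mp p ∣ cpoly R a * mp y0 := by
      rw [← e, hyh]
      exact Dvd.intro (cpoly R b * h) (by ring)
    exact (cpoly_unit ha).dvd_mul_left.1 this
  obtain ⟨c, rfl⟩ := hd
  rw [mp_mul] at ym e
  have cm : mp c ∈ mon R f := mon_of_mul (mp_int _) (mp_int p) (mul_comm (mp p) (mp c) ▸ ym)
  have h3 : cpoly R b * y ∈ J := by
    rw [e, mul_comm]
    exact hJ.1.2 _ (hJ.1.2 _ hpJ _ cm) _ am
  exact (hJ.2 _ bm _ hy h3).resolve_left (hJR b)

theorem pIdlP_prime {f g : PK R} (hg : Irreducible g) : IsPrimeSIdeal (mon R f) (pIdlP R f g) := by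
  refine ⟨⟨fun z hz => hz.1, ?_⟩, ?_⟩
  · rintro _ ⟨hz, h, rfl⟩ w hw
    exact ⟨mon_mul R hz hw, h * w, by ring⟩
  · rintro a ha b hb ⟨-, hab⟩
    rcases hg.prime.dvd_or_dvd (show g ∣ a * b from hab) with h | h
    · exact Or.inl ⟨ha, h⟩
    · exact Or.inr ⟨hb, h⟩

theorem pIdlP_noconst {f g : PK R} (hg : Irreducible g) (r : R) : cpoly R r ∉ pIdlP R f g := by
  rintro ⟨hm, h⟩
  have hr : r ≠ 0 := by
    rintro rfl
    exact hm.2.1 (by simp [cpoly])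
  exact hg.not_isUnit (isUnit_of_dvd_unit (show g ∣ cpoly R r from h) (cpoly_unit hr))

theorem pIdlP_self {f g : PK R} (hg : g ∈ mon R f) : g ∈ pIdlP R f g := ⟨hg, 1, (mul_one g).symm⟩

theorem pIdlP_congr {f g g' : PK R} (h : Associated g g') : pIdlP R f g = pIdlP R f g' := by
  ext z
  exact and_congr_right fun _ => h.dvd_iff_dvd_left

theorem irr_map {p : R[X]} (hp : Irreducible p) (hd : 0 < p.natDegree) : Irreducible (mp p) :=
  (hp.isPrimitive hd.ne').irreducible_iff_irreducible_map_fraction_map.1 hp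

theorem atom_lift {g : PK R} (h : g ∈ rxSet R ∧ IsMAtom (rxnz R) g ∧ 0 < g.natDegree) :
    ∃ p : R[X], Irreducible p ∧ 0 < p.natDegree ∧ g = mp p := by
  obtain ⟨h1, h2, h3⟩ := h
  obtain ⟨p, rfl⟩ := rx_lift h1
  exact ⟨p, (atom_iff p).1 h2, by rwa [mp_natDegree] at h3, rfl⟩

theorem assoc_of_sub {f g g' : PK R} (hg : Irreducible g) (hg' : Irreducible g')
    (hm : g' ∈ mon R f) (h : pIdlP R f g' ⊆ pIdlP R f g) : Associated g g' :=
  hg.associated_of_dvd hg' (h (pIdlP_self hm)).2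

theorem pIdlP_heightOne {f : PK R} (hf : f ∈ rxSet R) (hf0 : f ≠ 0) {g : PK R}
    (hg : Irreducible g) (hm : g ∈ mon R f) : IsHeightOnePrime (mon R f) (pIdlP R f g) := by
  refine ⟨pIdlP_prime hg, ⟨g, pIdlP_self hm⟩, fun J hJ hne hsub => ?_⟩
  obtain ⟨p, hp, hd, hpm, hpJ⟩ := key_prime hf hf0 hJ hne fun r hr => pIdlP_noconst hg r (hsub hr)
  refine hsub.antisymm ?_
  rwa [pIdlP_congr (assoc_of_sub hg (irr_map hp hd) hpm (hpJ.trans hsub))]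

theorem part_one {f : PK R} (hf : f ∈ rxSet R) (hf0 : f ≠ 0) :
    {P : Set (PK R) | IsHeightOnePrime (mon R f) P ∧ ∀ r : R, cpoly R r ∉ P} =
        {A : Set (PK R) | ∃ g, (g ∈ mon R f ∧ g ∈ rxSet R ∧ IsMAtom (rxnz R) g ∧
          0 < g.natDegree) ∧ A = pIdlP R f g} := by
  ext P
  constructor
  · rintro ⟨⟨hP, hne, hmin⟩, hR⟩
    obtain ⟨p, hp, hd, hpm, hpJ⟩ := key_prime hf hf0 hP hne hR
    refine ⟨mp p, ⟨hpm, mp_rx p, (atom_iff p).2 hp, by rwa [mp_natDegree]⟩, ?_⟩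
    exact (hmin _ (pIdlP_prime (irr_map hp hd)) ⟨_, pIdlP_self hpm⟩ hpJ).symm
  · rintro ⟨g, ⟨hm, h⟩, rfl⟩
    obtain ⟨p, hp, hd, rfl⟩ := atom_lift h
    exact ⟨pIdlP_heightOne hf hf0 (irr_map hp hd) hm, pIdlP_noconst (irr_map hp hd)⟩

end Helpers

end IVP

open IVP Pointwise Polynomial
/-- Corollary `charemptsect`. -/
theorem stmt_10 (R : Type*) [CommRing R] [IsDomain R] [UniqueFactorizationMonoid R]
    (f : PK R) (hf : f ∈ rxSet R) (hf0 : f ≠ 0) :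
    ({P : Set (PK R) | IsHeightOnePrime (mon R f) P ∧ ∀ r : R, cpoly R r ∉ P} =
        {A : Set (PK R) | ∃ g, (g ∈ mon R f ∧ g ∈ rxSet R ∧ IsMAtom (rxnz R) g ∧
          0 < g.natDegree) ∧ A = pIdlP R f g}) ∧
    ({A : Set (PK R) | ∃ g, (g ∈ mon R f ∧ g ∈ rxSet R ∧ IsMAtom (rxnz R) g ∧
          0 < g.natDegree) ∧ A = pIdlP R f g} =
        {A : Set (PK R) | ∃ g, (g ∈ mon R f ∧ Irreducible g) ∧ A = pIdlP R f g}) ∧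
    ∀ ℛ : Set (PK R),
      (∀ t ∈ ℛ, t ∈ mon R f ∧ t ∈ rxSet R ∧ IsMAtom (rxnz R) t ∧ 0 < t.natDegree) →
      (∀ g : PK R, (g ∈ mon R f ∧ g ∈ rxSet R ∧ IsMAtom (rxnz R) g ∧ 0 < g.natDegree) →
        ∃! t, t ∈ ℛ ∧ MAssoc (mon R f) g t) →
      Set.BijOn (fun t => pIdlP R f t) ℛ
        {P : Set (PK R) | IsHeightOnePrime (mon R f) P ∧ ∀ r : R, cpoly R r ∉ P} := by
  refine ⟨part_one hf hf0, ?_, ?_⟩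
  · ext A
    constructor
    · rintro ⟨g, ⟨hm, h⟩, rfl⟩
      obtain ⟨p, hp, hd, rfl⟩ := atom_lift h
      exact ⟨mp p, ⟨hm, irr_map hp hd⟩, rfl⟩
    · rintro ⟨g, ⟨hm, hg⟩, rfl⟩
      rw [← part_one hf hf0]
      exact ⟨pIdlP_heightOne hf hf0 hg hm, pIdlP_noconst hg⟩
  · intro ℛ hR hrep
    rw [part_one hf hf0]
    have one_assoc : ∀ t : PK R, MAssoc (mon R f) t t := fun t =>
      ⟨1, ⟨mon_one R f, 1, mon_one R f, mul_one 1⟩, (mul_one t).symm⟩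
    refine ⟨fun t ht => ⟨t, hR t ht, rfl⟩, ?_, ?_⟩
    · intro t ht t' ht' heq
      have hm := hR t ht
      have hm' := hR t' ht'
      obtain ⟨p, hp, hd, rfl⟩ := atom_lift hm.2
      obtain ⟨p', hp', hd', rfl⟩ := atom_lift hm'.2
      refine (hrep _ hm).unique ⟨ht, one_assoc _⟩ ⟨ht', ?_⟩
      have heq' : pIdlP R f (mp p) = pIdlP R f (mp p') := heq
      have h1 : mp p ∣ mp p' := (heq' ▸ pIdlP_self hm'.1 : mp p' ∈ pIdlP R f (mp p)).2
      have h2 : p ∣ p' :=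
        (hp.isPrimitive hd.ne').dvd_of_fraction_map_dvd_fraction_map (K := Kq R) h1
      obtain ⟨u, rfl⟩ := hp.associated_of_dvd hp' h2
      have hu : mp (u : R[X]) * mp ((u⁻¹ : (R[X])ˣ) : R[X]) = 1 := by
        rw [← mp_mul, Units.mul_inv, mp_one]
      have um : mp (u : R[X]) ∈ mon R f :=
        mon_of_mul (mp_int _) (mp_int _) (hu ▸ mon_one R f)
      have um' : mp ((u⁻¹ : (R[X])ˣ) : R[X]) ∈ mon R f :=
        mon_of_mul (mp_int _) (mp_int _) (by rw [mul_comm, hu]; exact mon_one R f)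
      exact ⟨mp (u : R[X]), ⟨um, _, um', hu⟩, mp_mul _ _⟩
    · rintro A ⟨g, hg, rfl⟩
      obtain ⟨t, ⟨ht, ε, ⟨-, v, -, hv⟩, rfl⟩, -⟩ := hrep g hg
      refine ⟨_, ht, ?_⟩
      exact (pIdlP_congr (associated_mul_unit_right g ε (IsUnit.of_mul_eq_one _ hv))).symm
end
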